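/- arXiv:math/0511459 — 4 statements merged into one kernel-verified Lean document; each statement's English description precedes it below -/
import Mathlib

section
/- Let k and n be integers with n ≥ k ≥ 1, and let H_1, …, H_q be hyperplanes in P^k over a field F, not necessarily distinct, in n-subgeneral position. If q > 2n − k + 1, then there exist real numbers ω_1, …, ω_q (Nochka weights) such that: (i) ω_i ≥ 0 for all i; (ii) ω_i ≤ τ for all i, where τ = (Σ_{i=1}^q ω_i − k − 1)/(q − 2n + k − 1); and (iii) for every nonempty linear subspace L ⊆ P^k, Σ_{{i : H_i ⊇ L}} ω_i ≤ codim L. -/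
open scoped Classical

/-- Distinct hyperplanes `H 0, …, H (q-1)` of `ℙⁿ` (recorded as their affine cones, i.e. as
`n`-dimensional linear subspaces of `F^(n+1)`) are *in general position* if any `m` of them with
`m ≤ n + 1` intersect in a projective linear subspace of codimension `m` (equivalently, their
affine cones intersect in a linear subspace of vector dimension `n + 1 - m`; for `m = n + 1`
the intersection is empty, i.e. the cones meet only at `0`). -/
def InGeneralPosition (F : Type*) [Field F] (n q : ℕ)
    (H : Fin q → Submodule F (Fin (n + 1) → F)) : Prop :=
  Function.Injective H ∧ (∀ i, Module.finrank F (H i) = n) ∧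
    ∀ I : Finset (Fin q), I.card ≤ n + 1 →
      Module.finrank F ↥(⨅ i ∈ I, H i) = n + 1 - I.card

/-- Hyperplanes `H 0, …, H (q-1)` of `ℙᵏ` (as linear subspaces of `F^(k+1)`), not necessarily
distinct, are *in `n`-subgeneral position* if there are a linear embedding `φ` of `ℙᵏ` as a
linear subspace of `ℙⁿ` (i.e. an injective linear map `F^(k+1) →ₗ F^(n+1)`) and distinct
hyperplanes `H' 0, …, H' (q-1)` of `ℙⁿ` in general position with `H i = H' i ∩ ℙᵏ`
(i.e. `H i = (H' i).comap φ`) for all `i`. -/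
def InSubgeneralPosition (F : Type*) [Field F] (k n q : ℕ)
    (H : Fin q → Submodule F (Fin (k + 1) → F)) : Prop :=
  ∃ (φ : (Fin (k + 1) → F) →ₗ[F] (Fin (n + 1) → F))
    (H' : Fin q → Submodule F (Fin (n + 1) → F)),
    Function.Injective φ ∧ InGeneralPosition F n q H' ∧
    ∀ i, H i = (H' i).comap φ

namespace Nochka

/-- A submodular set function vanishing on `∅` dominates an additive one with the same
value on `A`. -/
theorem exists_additive_le_of_submodular {E : Type*} [DecidableEq E] (f : Finset E → ℝ)
    (h0 : f ∅ = 0) (hsub : ∀ S T, f (S ∪ T) + f (S ∩ T) ≤ f S + f T) (A : Finset E) :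
    ∃ w : E → ℝ, (∀ S ⊆ A, ∑ i ∈ S, w i ≤ f S) ∧ ∑ i ∈ A, w i = f A := by
  induction A using Finset.induction_on with
  | empty =>
    refine ⟨0, fun S hS => ?_, by simp [h0]⟩
    rw [Finset.subset_empty.mp hS]
    simp [h0]
  | insert a A ha ih =>
    obtain ⟨w, hw, hA⟩ := ih
    have hne : ∀ T ⊆ A, ∀ c : ℝ, ∑ i ∈ T, Function.update w a c i = ∑ i ∈ T, w i := by
      intro T hT c
      refine Finset.sum_congr rfl fun i hi => ?_
      rw [Function.update_of_ne]
      rintro rfl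
      exact ha (hT hi)
    refine ⟨Function.update w a (f (insert a A) - f A), fun S hS => ?_, ?_⟩
    · by_cases haS : a ∈ S
      · have hS' : S.erase a ⊆ A := by
          intro i hi
          have := hS (Finset.mem_of_mem_erase hi)
          exact Finset.mem_of_mem_insert_of_ne this (Finset.ne_of_mem_erase hi)
        rw [← Finset.add_sum_erase _ _ haS, hne _ hS', Function.update_self]
        have hu : S ∪ A = insert a A := by
          ext i
          have := @hS i
          grind
        have hi : S ∩ A = S.erase a := by
          ext i
          have := @hS i
          grind
        have h := hsub S A
        rw [hu, hi] at h
        linarith [hw _ hS']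
      · have hS' : S ⊆ A := (Finset.subset_insert_iff_of_notMem haS).mp hS
        rw [hne _ hS']
        exact hw S hS'
    · rw [Finset.sum_insert ha, hne _ subset_rfl, Function.update_self, hA]
      ring

theorem card_union_sdiff_union_add_le {E : Type*} [DecidableEq E] (S S' T T' : Finset E) :
    ((S ∪ S') \ (T ∪ T')).card + ((S ∩ S') \ (T ∩ T')).card
      ≤ (S \ T).card + (S' \ T').card := by
  rw [← Finset.card_union_add_card_inter, ← Finset.card_union_add_card_inter (S \ T)]
  exact add_le_add (Finset.card_le_card fun i => by grind)
    (Finset.card_le_card fun i => by grind)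

/-- The truncation of `r` by the multiple `τ • card` of the counting function. -/
noncomputable def truncation {E : Type*} [Fintype E] [DecidableEq E] (r : Finset E → ℕ) (τ : ℝ)
    (S : Finset E) : ℝ :=
  Finset.univ.inf' ⟨∅, Finset.mem_univ _⟩ fun T : Finset E => (r T : ℝ) + τ * (S \ T).card

section truncation

variable {E : Type*} [Fintype E] [DecidableEq E] {r : Finset E → ℕ} {τ : ℝ}

theorem truncation_le (S T : Finset E) : truncation r τ S ≤ r T + τ * (S \ T).card :=
  Finset.inf'_le _ (Finset.mem_univ T)

theorem exists_truncation_eq (r : Finset E → ℕ) (τ : ℝ) (S : Finset E) :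
    ∃ T, truncation r τ S = r T + τ * (S \ T).card := by
  obtain ⟨T, -, hT⟩ := Finset.exists_mem_eq_inf' (⟨∅, Finset.mem_univ _⟩ : Finset.univ.Nonempty)
    fun T : Finset E => (r T : ℝ) + τ * (S \ T).card
  exact ⟨T, hT⟩

theorem truncation_le_self (S : Finset E) : truncation r τ S ≤ r S := by
  simpa using truncation_le (r := r) (τ := τ) S S

theorem truncation_mono (hτ : 0 ≤ τ) : Monotone (truncation r τ) := by
  intro S S' h
  obtain ⟨T, hT⟩ := exists_truncation_eq r τ S'
  rw [hT]
  refine (truncation_le S T).trans ?_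
  gcongr

theorem truncation_submodular (hτ : 0 ≤ τ) (hsub : ∀ S T, r (S ∪ T) + r (S ∩ T) ≤ r S + r T)
    (S S' : Finset E) :
    truncation r τ (S ∪ S') + truncation r τ (S ∩ S')
      ≤ truncation r τ S + truncation r τ S' := by
  obtain ⟨T, hT⟩ := exists_truncation_eq r τ S
  obtain ⟨T', hT'⟩ := exists_truncation_eq r τ S'
  have h1 := truncation_le (r := r) (τ := τ) (S ∪ S') (T ∪ T')
  have h2 := truncation_le (r := r) (τ := τ) (S ∩ S') (T ∩ T')
  have h3 : ((r (T ∪ T') : ℝ) + r (T ∩ T')) ≤ r T + r T' := mod_cast hsub T T'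
  have h4 : ((((S ∪ S') \ (T ∪ T')).card : ℝ) + ((S ∩ S') \ (T ∩ T')).card)
      ≤ (S \ T).card + (S' \ T').card := mod_cast card_union_sdiff_union_add_le S S' T T'
  have h5 := mul_le_mul_of_nonneg_left h4 hτ
  rw [hT, hT']
  linarith

end truncation

/-- If `P` minimizes `r T - τ * #T` among its subsets, then the polymatroid of `r` contains a
point bounded by `τ` whose sum over `P` is `r P`. -/
theorem exists_bounded_base {E : Type*} [Fintype E] [DecidableEq E] {r : Finset E → ℕ} {τ : ℝ}
    (hτ : 0 ≤ τ) (h0 : r ∅ = 0) (hmono : Monotone r)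
    (hsub : ∀ S T, r (S ∪ T) + r (S ∩ T) ≤ r S + r T) (P : Finset E)
    (hP : ∀ T ⊆ P, (r P : ℝ) ≤ r T + τ * (P \ T).card) :
    ∃ w : E → ℝ, (∀ i ∈ P, 0 ≤ w i) ∧ (∀ i ∈ P, w i ≤ τ) ∧
      (∀ S ⊆ P, ∑ i ∈ S, w i ≤ r S) ∧ ∑ i ∈ P, w i = r P := by
  have hempty : truncation r τ ∅ = 0 := by
    refine le_antisymm (by simpa [h0] using truncation_le_self (r := r) (τ := τ) ∅) ?_
    obtain ⟨T, hT⟩ := exists_truncation_eq r τ ∅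
    rw [hT]
    positivity
  obtain ⟨w, hw, hwP⟩ := exists_additive_le_of_submodular (truncation r τ) hempty
    (truncation_submodular hτ hsub) P
  have hPeq : truncation r τ P = r P := by
    refine le_antisymm (truncation_le_self P) ?_
    obtain ⟨T, hT⟩ := exists_truncation_eq r τ P
    have h1 := hP (P ∩ T) Finset.inter_subset_left
    have h2 : (r (P ∩ T) : ℝ) ≤ r T := mod_cast hmono Finset.inter_subset_right
    rw [Finset.sdiff_inter_self_left] at h1
    rw [hT]
    linarith
  refine ⟨w, fun i hi => ?_, fun i hi => ?_, fun S hS => (hw S hS).trans (truncation_le_self S),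
    hwP.trans hPeq⟩
  · have h1 := hw _ (Finset.erase_subset i P)
    have h2 := truncation_mono (r := r) hτ (Finset.erase_subset i P)
    have h3 := Finset.add_sum_erase P w hi
    linarith
  · have h1 := hw {i} (Finset.singleton_subset_iff.mpr hi)
    have h2 := truncation_le (r := r) (τ := τ) {i} ∅
    simp [h0] at h1 h2
    linarith

/-- Nochka weights for the rank function `r` of a matroid of rank at most `k + 1` in which every
set `S` of rank at most `k` satisfies `#S ≤ n - k + r S`. -/
theorem exists_weights_of_rank {E : Type*} [Fintype E] [DecidableEq E] (k n : ℕ) (hkn : k ≤ n)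
    (hq : 2 * n + 1 < Fintype.card E + k) (r : Finset E → ℕ)
    (hmono : Monotone r) (hsub : ∀ S T, r (S ∪ T) + r (S ∩ T) ≤ r S + r T)
    (hcard : ∀ S, r S ≤ S.card) (hrank : ∀ S, r S ≤ k + 1)
    (hgen : ∀ S, r S ≤ k → S.card + k ≤ n + r S) :
    ∃ w : E → ℝ, (∀ i, 0 ≤ w i) ∧
      (∀ i, w i ≤ ((∑ j, w j) - k - 1) / ((Fintype.card E : ℝ) - 2 * n + k - 1)) ∧
      ∀ S, r S ≤ k → ∑ i ∈ S, w i ≤ r S := by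
  have h0 : r ∅ = 0 := by simpa using hcard ∅
  have hkn' : (k : ℝ) ≤ n := mod_cast hkn
  have hgenR : ∀ S, r S ≤ k → (S.card : ℝ) + k ≤ n + r S := fun S hS => mod_cast hgen S hS
  have hkR : ∀ S, r S ≤ k → (r S : ℝ) ≤ k := fun S hS => mod_cast hS
  obtain ⟨P, hPk, hPmax⟩ := Finset.exists_max_image
    (Finset.univ.filter fun S : Finset E => r S ≤ k)
    (fun S => ((k : ℝ) + 1 - r S) / (2 * n - k + 1 - S.card)) ⟨∅, by simp [h0]⟩
  simp only [Finset.mem_filter, Finset.mem_univ, true_and] at hPk hPmax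
  have hden : ∀ S, r S ≤ k → (0 : ℝ) < 2 * n - k + 1 - S.card := fun S hS => by
    linarith [hgenR S hS, hkR S hS]
  set τ : ℝ := ((k : ℝ) + 1 - r P) / (2 * n - k + 1 - P.card) with hτ
  have hτP : τ * (2 * n - k + 1 - P.card) = k + 1 - r P := div_mul_cancel₀ _ (hden P hPk).ne'
  have hτS : ∀ S, r S ≤ k → k + 1 - r S ≤ τ * (2 * n - k + 1 - S.card) := fun S hS =>
    (div_le_iff₀ (hden S hS)).mp (hPmax S hS)
  have hτ0 : 0 ≤ τ := div_nonneg (by linarith [hkR P hPk]) (hden P hPk).le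
  obtain ⟨w, hw0, hwτ, hwS, hwP⟩ := exists_bounded_base hτ0 h0 hmono hsub P fun T hT => by
    have h1 := hτS T ((hmono hT).trans hPk)
    have h2 : ((P \ T).card : ℝ) = P.card - T.card := by
      rw [Finset.card_sdiff_of_subset hT, Nat.cast_sub (Finset.card_le_card hT)]
    rw [h2]
    linarith
  have hsum : ∀ S, ∑ i ∈ S, (if i ∈ P then w i else τ)
      = ∑ i ∈ S ∩ P, w i + τ * (S \ P).card := fun S => by
    rw [Finset.sum_ite, Finset.filter_mem_eq_inter, Finset.filter_notMem_eq_sdiff,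
      Finset.sum_const, nsmul_eq_mul, mul_comm]
  refine ⟨fun i => if i ∈ P then w i else τ, fun i => ?_, fun i => ?_, fun S hS => ?_⟩
  · dsimp only
    split_ifs with h
    exacts [hw0 i h, hτ0]
  · have hD : (0 : ℝ) < (Fintype.card E : ℝ) - 2 * n + k - 1 := by
      have : (2 * n + 1 : ℝ) < Fintype.card E + k := mod_cast hq
      linarith
    have htot : ((∑ j, if j ∈ P then w j else τ) - k - 1)
        / ((Fintype.card E : ℝ) - 2 * n + k - 1) = τ := by
      rw [div_eq_iff hD.ne', hsum, Finset.univ_inter, hwP,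
        Finset.card_sdiff_of_subset (Finset.subset_univ P),
        Nat.cast_sub (Finset.card_le_card (Finset.subset_univ P)), Finset.card_univ]
      linarith
    rw [htot]
    dsimp only
    split_ifs with h
    exacts [hwτ i h, le_rfl]
  · rw [hsum]
    have hwSP := hwS (S ∩ P) Finset.inter_subset_right
    have hsubR : (r (S ∪ P) : ℝ) + r (S ∩ P) ≤ r S + r P := mod_cast hsub S P
    by_cases hU : r (S ∪ P) ≤ k
    · have h1 := hτS _ hU
      have h2 : ((S ∪ P).card : ℝ) = (S \ P).card + P.card :=
        mod_cast (Finset.card_sdiff_add_card S P).symm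
      rw [h2] at h1
      linarith
    · have hU' : (r (S ∪ P) : ℝ) = k + 1 := by
        exact_mod_cast le_antisymm (hrank _) (by omega)
      have h1 : ((S \ P).card : ℝ) + (S ∩ P).card = S.card :=
        mod_cast Finset.card_sdiff_add_card_inter S P
      have h2 : (r (S ∩ P) : ℝ) ≤ (S ∩ P).card := mod_cast hcard _
      have h3 := hgenR S hS
      have h4 := hgenR P hPk
      have h5 := hkR P hPk
      have hτ1 : τ ≤ 1 := by
        rw [hτ, div_le_one (hden P hPk)]
        linarith
      -- With `x = r S - r (S ∩ P)` and `c = k + 1 - r P ≤ x`, bound `τ * (n - k + x) ≤ x`.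
      have h6 : τ * (S \ P).card ≤ τ * (n - k + (r S - r (S ∩ P))) :=
        mul_le_mul_of_nonneg_left (by linarith) hτ0
      have h7 : τ * (n - k + (k + 1 - r P)) ≤ k + 1 - r P := by
        rw [← hτP]
        exact mul_le_mul_of_nonneg_left (by rw [hτP]; linarith) hτ0
      have h8 := mul_nonneg (sub_nonneg.mpr hτ1)
        (show (0 : ℝ) ≤ (r S - r (S ∩ P)) - (k + 1 - r P) by linarith)
      linarith

section rank

variable {F : Type*} [Field F] {k q : ℕ} (H : Fin q → Submodule F (Fin (k + 1) → F))

/-- The vector codimension of the intersection of the subspaces indexed by `S`. -/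
noncomputable def codimInf (S : Finset (Fin q)) : ℕ :=
  k + 1 - Module.finrank F ↥(S.inf H)

theorem codimInf_add_finrank (S : Finset (Fin q)) :
    codimInf H S + Module.finrank F ↥(S.inf H) = k + 1 := by
  have h := Submodule.finrank_le (S.inf H)
  rw [Module.finrank_fin_fun] at h
  exact Nat.sub_add_cancel h

theorem codimInf_mono : Monotone (codimInf H) := fun _ _ h =>
  Nat.sub_le_sub_left (Submodule.finrank_mono (Finset.inf_mono h)) _

theorem codimInf_submodular (S T : Finset (Fin q)) :
    codimInf H (S ∪ T) + codimInf H (S ∩ T) ≤ codimInf H S + codimInf H T := by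
  have h := Submodule.finrank_sup_add_finrank_inf_eq (S.inf H) (T.inf H)
  rw [← Finset.inf_union] at h
  have hle : S.inf H ⊔ T.inf H ≤ (S ∩ T).inf H :=
    sup_le (Finset.inf_mono Finset.inter_subset_left) (Finset.inf_mono Finset.inter_subset_right)
  have := Submodule.finrank_mono hle
  have := codimInf_add_finrank H S
  have := codimInf_add_finrank H T
  have := codimInf_add_finrank H (S ∪ T)
  have := codimInf_add_finrank H (S ∩ T)
  omega

theorem codimInf_le_card (hH : ∀ i, Module.finrank F (H i) = k) (S : Finset (Fin q)) :
    codimInf H S ≤ S.card := by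
  induction S using Finset.induction_on with
  | empty => rw [codimInf, Finset.inf_empty, finrank_top, Module.finrank_fin_fun]; simp
  | insert a S ha ih =>
    have h := codimInf_submodular H {a} S
    have h1 := codimInf_add_finrank H {a}
    rw [Finset.inf_singleton, hH a] at h1
    rw [Finset.card_insert_of_notMem ha, Finset.insert_eq]
    omega

theorem card_add_le_of_inSubgeneralPosition {n : ℕ} (hpos : InSubgeneralPosition F k n q H)
    (S : Finset (Fin q)) (hS : codimInf H S ≤ k) : S.card + k ≤ n + codimInf H S := by
  obtain ⟨φ, H', hφ, ⟨-, -, hgen⟩, hH⟩ := hpos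
  have hle : ∀ T ⊆ S, Module.finrank F ↥(S.inf H) ≤ Module.finrank F ↥(⨅ i ∈ T, H' i) := by
    intro T hT
    rw [(Submodule.equivMapOfInjective φ hφ (S.inf H)).finrank_eq]
    refine Submodule.finrank_mono (le_iInf₂ fun i hi => ?_)
    rw [Submodule.map_le_iff_le_comap, ← hH i]
    exact Finset.inf_le (hT hi)
  have hadd := codimInf_add_finrank H S
  have hcard : S.card ≤ n + 1 := by
    by_contra! hlt
    obtain ⟨T, hTS, hT⟩ := Finset.exists_subset_card_eq hlt.le
    have h1 := hle T hTS
    rw [hgen T hT.le, hT] at h1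
    omega
  have h1 := hle S subset_rfl
  rw [hgen S hcard] at h1
  omega

end rank

end Nochka

/-- **Nochka's theorem on weights (Main Theorem).**
Linear subspaces `L` of `ℙᵏ` are recorded as their affine cones, i.e. as linear subspaces of
`F^(k+1)`; thus the nonempty subspaces are those with `L ≠ ⊥`, and the projective codimension of
a nonempty `L` is `codim L = k - dim L = (k + 1) - finrank L`.
If `H 1, …, H q` are hyperplanes of `ℙᵏ` (not necessarily distinct) in `n`-subgeneral position,
where `n ≥ k ≥ 1`, and `q > 2n - k + 1`, then there are weights `ω 1, …, ω q ∈ ℝ` with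
(i) `ω i ≥ 0` for all `i`;
(ii) `ω i ≤ τ` for all `i`, where `τ = (∑ ω i - k - 1)/(q - 2n + k - 1)`;
(iii) `∑_{i : H i ⊇ L} ω i ≤ codim L` for every nonempty linear subspace `L ⊆ ℙᵏ`. -/
theorem nochka_weights (F : Type*) [Field F] (k n q : ℕ) (hk : 1 ≤ k) (hkn : k ≤ n)
    (H : Fin q → Submodule F (Fin (k + 1) → F))
    (hHhyp : ∀ i, Module.finrank F (H i) = k)
    (hpos : InSubgeneralPosition F k n q H)
    (hq : 2 * n + 1 < q + k) :
    ∃ ω : Fin q → ℝ,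
      (∀ i, 0 ≤ ω i) ∧
      (∀ i, ω i ≤ ((∑ j, ω j) - k - 1) / ((q : ℝ) - 2 * n + k - 1)) ∧
      (∀ L : Submodule F (Fin (k + 1) → F), L ≠ ⊥ →
        ∑ i ∈ Finset.univ.filter (fun i => L ≤ H i), ω i
          ≤ (k : ℝ) + 1 - Module.finrank F L) := by
  obtain ⟨ω, h0, hτ, hω⟩ := Nochka.exists_weights_of_rank k n hkn (by simpa using hq)
    (Nochka.codimInf H) (Nochka.codimInf_mono H) (Nochka.codimInf_submodular H)
    (Nochka.codimInf_le_card H hHhyp) (fun _ => Nat.sub_le _ _)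
    (Nochka.card_add_le_of_inSubgeneralPosition H hpos)
  refine ⟨ω, h0, by simpa using hτ, fun L hL => ?_⟩
  set S := Finset.univ.filter fun i => L ≤ H i
  have hLS : L ≤ S.inf H := Finset.le_inf fun i hi => (Finset.mem_filter.mp hi).2
  have hfin := Submodule.finrank_mono hLS
  have hpos' : 0 < Module.finrank F L :=
    Nat.pos_of_ne_zero fun h => hL (Submodule.finrank_eq_zero.mp h)
  have hadd := Nochka.codimInf_add_finrank H S
  have hcodim : (Nochka.codimInf H S : ℝ) + Module.finrank F L ≤ k + 1 := by
    exact_mod_cast (by omega : Nochka.codimInf H S + Module.finrank F L ≤ k + 1)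
  linarith [hω S (by omega)]
end

section
/- Let k and n be integers with n ≥ k ≥ 1, and let H_1, …, H_q be hyperplanes in P^k over a field F, not necessarily distinct, in n-subgeneral position, with q > 2n − k + 1. Then the Nochka weights ω_1, …, ω_q of the Main Theorem can be chosen so that, in addition to conditions (i) ω_i ≥ 0, (ii) ω_i ≤ τ where τ = (Σ_{i=1}^q ω_i − k − 1)/(q − 2n + k − 1), and (iii) Σ_{{i : H_i ⊇ L}} ω_i ≤ codim L for every nonempty linear subspace L ⊆ P^k, one also has τ ≤ (k + 1)/(n + 1). -/
open scoped Classical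

/-- A submodular function `r` on the subsets of `T₀` for which `r - τ · card` is minimal at `T₀`
admits a vector in its polytope, with entries in `[0, τ]`, whose total weight on `T₀` is `r T₀`. -/
lemma exists_weights_of_minimal {α : Type*} [Fintype α] [DecidableEq α] (r : Finset α → ℝ)
    (hempty : r ∅ = 0) (hnonneg : ∀ S, 0 ≤ r S)
    (hsub : ∀ S T, r (S ∪ T) + r (S ∩ T) ≤ r S + r T)
    (T₀ : Finset α) (τ : ℝ) (hτ : 0 ≤ τ)
    (hmin : ∀ S ⊆ T₀, r T₀ + τ * S.card ≤ r S + τ * T₀.card) :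
    ∃ ω : α → ℝ, (∀ i, 0 ≤ ω i) ∧ (∀ i, ω i ≤ τ) ∧ (∀ S ⊆ T₀, ∑ i ∈ S, ω i ≤ r S) ∧
      ∑ i ∈ T₀, ω i = r T₀ := by
  set P : Set (α → ℝ) := Set.Icc 0 (fun _ => τ) ∩ ⋂ S ∈ T₀.powerset, {ω | ∑ i ∈ S, ω i ≤ r S}
    with hP
  have hPmem : ∀ ω, ω ∈ P ↔
      ((∀ i, 0 ≤ ω i) ∧ (∀ i, ω i ≤ τ)) ∧ ∀ S ⊆ T₀, ∑ i ∈ S, ω i ≤ r S := by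
    intro ω
    simp [hP, Pi.le_def]
  have hcompact : IsCompact P := by
    refine isCompact_Icc.inter_right (isClosed_biInter fun S _ => ?_)
    exact isClosed_le (by fun_prop) continuous_const
  have hne : P.Nonempty := ⟨0, (hPmem 0).2 ⟨⟨by simp, by simpa using fun _ => hτ⟩,
    fun S _ => by simpa using hnonneg S⟩⟩
  obtain ⟨ω, hωP, hmax⟩ := hcompact.exists_isMaxOn hne
    (f := fun ω : α → ℝ => ∑ i ∈ T₀, ω i) (by fun_prop)
  obtain ⟨⟨hω0, hωτ⟩, hωr⟩ := (hPmem ω).1 hωP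
  have htight : ∀ i ∈ T₀, ω i < τ → ∃ S ⊆ T₀, i ∈ S ∧ ∑ j ∈ S, ω j = r S := by
    intro i hi hlt
    by_contra! hcon
    obtain ⟨S₀, hS₀, hS₀min⟩ := Finset.exists_min_image (T₀.powerset.filter (i ∈ ·))
      (fun S => r S - ∑ j ∈ S, ω j) ⟨T₀, by simp [hi]⟩
    simp only [Finset.mem_filter, Finset.mem_powerset] at hS₀ hS₀min
    have hslack : 0 < r S₀ - ∑ j ∈ S₀, ω j :=
      sub_pos.2 (lt_of_le_of_ne (hωr S₀ hS₀.1) (hcon S₀ hS₀.1 hS₀.2))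
    set ε := min (τ - ω i) (r S₀ - ∑ j ∈ S₀, ω j)
    have hε : 0 < ε := lt_min (sub_pos.2 hlt) hslack
    have hε₁ : ε ≤ τ - ω i := min_le_left _ _
    have hε₂ : ε ≤ r S₀ - ∑ j ∈ S₀, ω j := min_le_right _ _
    have hsum : ∀ S : Finset α, ∑ j ∈ S, (ω + Pi.single i ε : α → ℝ) j
        = ∑ j ∈ S, ω j + if i ∈ S then ε else 0 := by
      intro S
      simp [Finset.sum_add_distrib, Finset.sum_pi_single']
    have hmem : ω + Pi.single i ε ∈ P := by
      refine (hPmem _).2 ⟨⟨fun j => ?_, fun j => ?_⟩, fun S hS => ?_⟩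
      · rcases eq_or_ne j i with rfl | hj
        · simpa using add_nonneg (hω0 j) hε.le
        · simpa [hj] using hω0 j
      · rcases eq_or_ne j i with rfl | hj
        · simp only [Pi.add_apply, Pi.single_eq_same]
          linarith
        · simpa [hj] using hωτ j
      · rw [hsum]
        split_ifs with hiS
        · linarith [hS₀min S ⟨hS, hiS⟩]
        · simpa using hωr S hS
    have := hmax hmem
    simp only [Set.mem_ofPred_eq] at this
    rw [hsum, if_pos hi] at this
    linarith
  obtain ⟨T, hT, hTmax⟩ := Finset.exists_max_image
    (T₀.powerset.filter fun S => ∑ j ∈ S, ω j = r S) Finset.card ⟨∅, by simp [hempty]⟩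
  simp only [Finset.mem_filter, Finset.mem_powerset] at hT hTmax
  have houtside : ∀ i ∈ T₀ \ T, ω i = τ := by
    intro i hi
    rw [Finset.mem_sdiff] at hi
    by_contra hne
    obtain ⟨S, hST₀, hiS, hS⟩ := htight i hi.1 (lt_of_le_of_ne (hωτ i) hne)
    have hunion : ∑ j ∈ T ∪ S, ω j = r (T ∪ S) := by
      refine le_antisymm (hωr _ (Finset.union_subset hT.1 hST₀)) ?_
      linarith [hsub T S, hωr (T ∩ S) (Finset.inter_subset_left.trans hT.1),
        Finset.sum_union_inter (s₁ := T) (s₂ := S) (f := ω)]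
    have hle := hTmax (T ∪ S) ⟨Finset.union_subset hT.1 hST₀, hunion⟩
    have := Finset.eq_of_subset_of_card_le Finset.subset_union_left hle
    exact hi.2 (this ▸ Finset.mem_union_right T hiS)
  refine ⟨ω, hω0, hωτ, hωr, le_antisymm (hωr T₀ subset_rfl) ?_⟩
  rw [← Finset.sum_sdiff hT.1, Finset.sum_congr rfl houtside, hT.2, Finset.sum_const, nsmul_eq_mul,
    Finset.cast_card_sdiff hT.1]
  linarith [hmin T hT.1]

/-- Nochka weights for a polymatroid `r` of rank `K` in which every non-spanning set `S` has at
most `N - K + r S` elements. -/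
lemma exists_polymatroid_nochka_weights {α : Type*} [Fintype α] [DecidableEq α]
    (r : Finset α → ℝ) (K N : ℝ) (hempty : r ∅ = 0) (hmono : ∀ S T, S ⊆ T → r S ≤ r T)
    (hsub : ∀ S T, r (S ∪ T) + r (S ∩ T) ≤ r S + r T) (hcard : ∀ S, r S ≤ S.card)
    (hK : ∀ S, r S ≤ K) (hKpos : 0 < K) (hKN : K ≤ N)
    (hgen : ∀ S, r S < K → S.card ≤ N - K + r S) :
    ∃ (ω : α → ℝ) (τ : ℝ), (∀ i, 0 ≤ ω i) ∧ (∀ i, ω i ≤ τ) ∧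
      ∑ i, ω i = K + τ * (Fintype.card α - 2 * N + K) ∧
      (∀ S, r S < K → ∑ i ∈ S, ω i ≤ r S) ∧ τ ≤ K / N := by
  have hnonneg : ∀ S, 0 ≤ r S := fun S => hempty ▸ hmono ∅ S (Finset.empty_subset S)
  obtain ⟨T₀, hT₀, hT₀max⟩ := Finset.exists_max_image
    (Finset.univ.filter fun S : Finset α => r S < K)
    (fun S => (K - r S) / (2 * N - K - S.card)) ⟨∅, by simp [hempty, hKpos]⟩
  simp only [Finset.mem_filter, Finset.mem_univ, true_and] at hT₀ hT₀max
  set τ := (K - r T₀) / (2 * N - K - T₀.card) with hτdef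
  have hden : ∀ S, r S < K → 0 < 2 * N - K - S.card := fun S hS => by linarith [hgen S hS]
  have hτ : 0 ≤ τ := div_nonneg (by linarith) (hden T₀ hT₀).le
  have hτeq : τ * (2 * N - K - T₀.card) = K - r T₀ := div_mul_cancel₀ _ (hden T₀ hT₀).ne'
  have hτge : ∀ S, r S < K → K - r S ≤ τ * (2 * N - K - S.card) :=
    fun S hS => (div_le_iff₀ (hden S hS)).1 (hT₀max S hS)
  have hτN : τ * (N - r T₀) ≤ K - r T₀ := by
    rw [← hτeq]
    exact mul_le_mul_of_nonneg_left (by linarith [hgen T₀ hT₀]) hτ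
  have hτ1 : τ ≤ 1 := by
    by_contra! h
    nlinarith
  obtain ⟨ω, hω0, hωτ, hωr, hωT₀⟩ := exists_weights_of_minimal r hempty hnonneg hsub T₀ τ hτ
    (fun S hS => by linarith [hτge S ((hmono S T₀ hS).trans_lt hT₀)])
  refine ⟨fun i => if i ∈ T₀ then ω i else τ, τ, fun i => ?_, fun i => ?_, ?_, fun S hS => ?_, ?_⟩
  · dsimp only
    split_ifs
    exacts [hω0 i, hτ]
  · dsimp only
    split_ifs
    exacts [hωτ i, le_rfl]
  · rw [← Finset.sum_sdiff (Finset.subset_univ T₀),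
      Finset.sum_congr rfl (g := fun _ => τ) fun i hi => if_neg (Finset.mem_sdiff.1 hi).2,
      Finset.sum_congr (s₁ := T₀) rfl (g := ω) fun i hi => if_pos hi, hωT₀, Finset.sum_const,
      nsmul_eq_mul, Finset.cast_card_sdiff (Finset.subset_univ T₀), Finset.card_univ]
    linarith
  · have hsum : ∑ i ∈ S, (if i ∈ T₀ then ω i else τ)
        = ∑ i ∈ S ∩ T₀, ω i + (S \ T₀).card * τ := by
      rw [← Finset.sum_inter_add_sum_sdiff S T₀,
        Finset.sum_congr (s₁ := S ∩ T₀) rfl (g := ω)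
          fun i hi => if_pos (Finset.mem_inter.1 hi).2,
        Finset.sum_congr (s₁ := S \ T₀) rfl (g := fun _ => τ)
          fun i hi => if_neg (Finset.mem_sdiff.1 hi).2, Finset.sum_const, nsmul_eq_mul]
    have hinter := hωr (S ∩ T₀) Finset.inter_subset_right
    have hsubm := hsub S T₀
    have hdiff : ((S \ T₀).card : ℝ) + (S ∩ T₀).card = S.card := by
      exact_mod_cast Finset.card_sdiff_add_card_inter S T₀
    have hunion : ((S ∪ T₀).card : ℝ) + (S ∩ T₀).card = S.card + T₀.card := by
      exact_mod_cast Finset.card_union_add_card_inter S T₀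
    rw [hsum]
    suffices h : (S \ T₀).card * τ ≤ r S - r (S ∩ T₀) by linarith
    rcases (hK (S ∪ T₀)).lt_or_eq with h | h
    · have hge := hτge _ h
      rw [show ((S ∪ T₀).card : ℝ) = (S \ T₀).card + T₀.card by linarith] at hge
      linarith
    · have hle : ((S \ T₀).card : ℝ) ≤ N - K + (r S - r (S ∩ T₀)) := by
        linarith [hgen S hS, hcard (S ∩ T₀)]
      have h₁ := mul_le_mul_of_nonneg_right hle hτ
      have h₂ : 0 ≤ (1 - τ) * (r S - r (S ∩ T₀) - (K - r T₀)) :=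
        mul_nonneg (by linarith) (by linarith)
      linarith
  · rw [le_div_iff₀ (hKpos.trans_le hKN)]
    have := mul_nonneg (hnonneg T₀) (sub_nonneg.2 hτ1)
    linarith

/-- Hyperplanes in `n`-subgeneral position whose intersection contains a nonzero subspace `L`
number at most `n + 1 - finrank L`. -/
lemma InSubgeneralPosition.card_add_finrank_le {F : Type*} [Field F] {k n q : ℕ}
    {H : Fin q → Submodule F (Fin (k + 1) → F)} (hpos : InSubgeneralPosition F k n q H)
    {L : Submodule F (Fin (k + 1) → F)} (hL : L ≠ ⊥) {S : Finset (Fin q)}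
    (hS : ∀ i ∈ S, L ≤ H i) : S.card + Module.finrank F L ≤ n + 1 := by
  obtain ⟨φ, H', hφ, ⟨-, -, hgen⟩, hH⟩ := hpos
  have hLpos : 0 < Module.finrank F L :=
    Nat.pos_of_ne_zero fun h => hL (Submodule.finrank_eq_zero.1 h)
  have key : ∀ I ⊆ S, I.card ≤ n + 1 → Module.finrank F L ≤ n + 1 - I.card := by
    intro I hI hcard
    rw [← hgen I hcard, (Submodule.equivMapOfInjective φ hφ L).finrank_eq]
    refine Submodule.finrank_mono (le_iInf₂ fun i hi => Submodule.map_le_iff_le_comap.2 ?_)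
    exact hH i ▸ hS i (hI hi)
  rcases le_total S.card (n + 1) with h | h
  · have := key S subset_rfl h
    omega
  · obtain ⟨I, hI, hIcard⟩ := Finset.exists_subset_card_eq h
    have := key I hI hIcard.le
    omega

/-- **Nochka's theorem on weights (Main Theorem).**
Linear subspaces `L` of `ℙᵏ` are recorded as their affine cones, i.e. as linear subspaces of
`F^(k+1)`; thus the nonempty subspaces are those with `L ≠ ⊥`, and the projective codimension of
a nonempty `L` is `codim L = k - dim L = (k + 1) - finrank L`.
If `H 1, …, H q` are hyperplanes of `ℙᵏ` (not necessarily distinct) in `n`-subgeneral position,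
where `n ≥ k ≥ 1`, and `q > 2n - k + 1`, then there are weights `ω 1, …, ω q ∈ ℝ` with
(i) `ω i ≥ 0` for all `i`;
(ii) `ω i ≤ τ` for all `i`, where `τ = (∑ ω i - k - 1)/(q - 2n + k - 1)`;
(iii) `∑_{i : H i ⊇ L} ω i ≤ codim L` for every nonempty linear subspace `L ⊆ ℙᵏ`. -/
theorem nochka_weights_tau_le (F : Type*) [Field F] (k n q : ℕ) (hk : 1 ≤ k) (hkn : k ≤ n)
    (H : Fin q → Submodule F (Fin (k + 1) → F))
    (hHhyp : ∀ i, Module.finrank F (H i) = k)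
    (hpos : InSubgeneralPosition F k n q H)
    (hq : 2 * n + 1 < q + k) :
    ∃ ω : Fin q → ℝ,
      (∀ i, 0 ≤ ω i) ∧
      (∀ i, ω i ≤ ((∑ j, ω j) - k - 1) / ((q : ℝ) - 2 * n + k - 1)) ∧
      (∀ L : Submodule F (Fin (k + 1) → F), L ≠ ⊥ →
        ∑ i ∈ Finset.univ.filter (fun i => L ≤ H i), ω i
          ≤ (k : ℝ) + 1 - Module.finrank F L) ∧
      ((∑ j, ω j) - k - 1) / ((q : ℝ) - 2 * n + k - 1) ≤ ((k : ℝ) + 1) / ((n : ℝ) + 1) := by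
  have hanti : ∀ S T : Finset (Fin q), S ⊆ T → ⨅ i ∈ T, H i ≤ ⨅ i ∈ S, H i :=
    fun S T hST => biInf_mono hST
  set r : Finset (Fin q) → ℝ := fun S => (k : ℝ) + 1 - Module.finrank F ↥(⨅ i ∈ S, H i) with hr
  have hempty : r ∅ = 0 := by
    have : ⨅ i ∈ (∅ : Finset (Fin q)), H i = ⊤ := by simp
    simp only [hr]
    rw [this, finrank_top]
    simp
  have hmono : ∀ S T, S ⊆ T → r S ≤ r T := by
    intro S T hST
    have : (Module.finrank F ↥(⨅ i ∈ T, H i) : ℝ) ≤ Module.finrank F ↥(⨅ i ∈ S, H i) := by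
      exact_mod_cast Submodule.finrank_mono (hanti S T hST)
    simp only [hr]
    linarith
  have hsub : ∀ S T, r (S ∪ T) + r (S ∩ T) ≤ r S + r T := by
    intro S T
    have hdim := Submodule.finrank_sup_add_finrank_inf_eq (⨅ i ∈ S, H i) (⨅ i ∈ T, H i)
    have hle := Submodule.finrank_mono (sup_le (hanti (S ∩ T) S Finset.inter_subset_left)
      (hanti (S ∩ T) T Finset.inter_subset_right))
    rw [← Finset.iInf_union] at hdim
    have hcast : (Module.finrank F ↥(⨅ i ∈ S, H i) : ℝ) + Module.finrank F ↥(⨅ i ∈ T, H i)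
        ≤ Module.finrank F ↥(⨅ i ∈ S ∩ T, H i) + Module.finrank F ↥(⨅ i ∈ S ∪ T, H i) := by
      exact_mod_cast (by omega)
    simp only [hr]
    linarith
  have hcard : ∀ S, r S ≤ S.card := by
    intro S
    induction S using Finset.induction_on with
    | empty => simp [hempty]
    | insert i S hi ih =>
      have hone : r {i} = 1 := by
        have : ⨅ j ∈ ({i} : Finset (Fin q)), H j = H i := by simp
        simp only [hr]
        rw [this, hHhyp]
        ring
      have hsubm := hsub {i} S
      rw [Finset.singleton_inter_of_notMem hi, hempty, hone, ← Finset.insert_eq] at hsubm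
      rw [Finset.card_insert_of_notMem hi]
      push_cast
      linarith
  have hspan : ∀ S, r S < k + 1 ↔ ⨅ i ∈ S, H i ≠ ⊥ := by
    intro S
    rw [Ne, ← Submodule.finrank_eq_zero, ← Ne, ← Nat.pos_iff_ne_zero]
    simp [hr]
  have hkn' : (k : ℝ) ≤ n := by exact_mod_cast hkn
  obtain ⟨ω, τ, hω0, hωτ, hsum, hωr, hτ⟩ := exists_polymatroid_nochka_weights r (k + 1) (n + 1)
    hempty hmono hsub hcard (fun S => by simp [hr]) (by positivity) (by linarith) (fun S hS => by
      have := hpos.card_add_finrank_le ((hspan S).1 hS) fun i hi => biInf_le H hi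
      have hcast : (S.card : ℝ) + Module.finrank F ↥(⨅ i ∈ S, H i) ≤ n + 1 := by
        exact_mod_cast this
      simp only [hr]
      linarith)
  have hden : 0 < (q : ℝ) - 2 * n + k - 1 := by
    have : (2 * n + 1 : ℝ) < q + k := by exact_mod_cast hq
    linarith
  have hτeq : ((∑ j, ω j) - k - 1) / ((q : ℝ) - 2 * n + k - 1) = τ := by
    rw [div_eq_iff hden.ne', hsum, Fintype.card_fin]
    ring
  refine ⟨ω, hω0, hτeq ▸ hωτ, fun L hL => ?_, hτeq ▸ hτ⟩
  have hle : L ≤ ⨅ i ∈ Finset.univ.filter (fun i => L ≤ H i), H i :=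
    le_iInf₂ fun i hi => (Finset.mem_filter.1 hi).2
  refine (hωr _ ((hspan _).2 fun h => hL (le_bot_iff.1 (h ▸ hle)))).trans ?_
  have : (Module.finrank F L : ℝ)
      ≤ Module.finrank F ↥(⨅ i ∈ Finset.univ.filter (fun i => L ≤ H i), H i) := by
    exact_mod_cast Submodule.finrank_mono hle
  simp only [hr]
  linarith
end

section
/- (Toda's improvement.) Let k and n be integers with n ≥ k ≥ 1, and let H_1, …, H_q be hyperplanes in P^k over a field F, not necessarily distinct, in n-subgeneral position, with q > 2n − k + 1. Then the Nochka weights ω_1, …, ω_q of the Main Theorem can be chosen so that, in addition to conditions (i) ω_i ≥ 0, (ii) ω_i ≤ τ where τ = (Σ_{i=1}^q ω_i − k − 1)/(q − 2n + k − 1), and (iii) Σ_{{i : H_i ⊇ L}} ω_i ≤ codim L for every nonempty linear subspace L ⊆ P^k, one also has τ ≤ k/n. -/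
open scoped Classical

/-- The greedy algorithm for polymatroids: a normalized, monotone, submodular function dominates
a nonnegative vector that attains it on a prescribed set. -/
theorem exists_nonneg_sum_le_of_submodular {ι : Type*} [DecidableEq ι] (f : Finset ι → ℝ)
    (h_empty : f ∅ = 0) (h_mono : ∀ A B, A ⊆ B → f A ≤ f B)
    (h_sub : ∀ A B, f (A ∪ B) + f (A ∩ B) ≤ f A + f B) (S : Finset ι) :
    ∃ w : ι → ℝ, (∀ i, 0 ≤ w i) ∧ (∀ A ⊆ S, ∑ i ∈ A, w i ≤ f A) ∧ ∑ i ∈ S, w i = f S := by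
  induction S using Finset.induction_on with
  | empty =>
    refine ⟨fun _ => 0, fun _ => le_rfl, fun A hA => ?_, by simp [h_empty]⟩
    simp [Finset.subset_empty.1 hA, h_empty]
  | insert a S ha ih =>
    obtain ⟨w, hw0, hwA, hwS⟩ := ih
    have h_off : ∀ A : Finset ι, a ∉ A →
        ∑ i ∈ A, Function.update w a (f (insert a S) - f S) i = ∑ i ∈ A, w i := fun A hA =>
      Finset.sum_congr rfl fun i hi => Function.update_of_ne (ne_of_mem_of_not_mem hi hA) _ _
    refine ⟨Function.update w a (f (insert a S) - f S), fun i => ?_, fun A hA => ?_, ?_⟩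
    · rcases eq_or_ne i a with rfl | hi
      · simpa using h_mono _ _ (Finset.subset_insert i S)
      · simpa [Function.update_of_ne hi] using hw0 i
    · by_cases haA : a ∈ A
      · have h_inter : A ∩ S = A.erase a := by grind
        have h_union : A ∪ S = insert a S := by grind
        have h1 := h_sub A S
        have h2 := hwA (A.erase a) (by grind)
        rw [h_inter, h_union] at h1
        rw [← Finset.add_sum_erase _ _ haA, h_off _ (Finset.notMem_erase a A),
          Function.update_self]
        linarith
      · rw [h_off A haA]
        exact hwA A (by grind)
    · rw [Finset.sum_insert ha, h_off S ha, hwS, Function.update_self]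
      ring

/-- A monotone submodular function remains so after reduction by the vector with all
coordinates `τ`; hence a vector below it with all coordinates at most `τ` exists. -/
theorem exists_bounded_sum_le_of_submodular {ι : Type*} [DecidableEq ι] (r : Finset ι → ℝ)
    (h_empty : r ∅ = 0) (h_mono : ∀ A B, A ⊆ B → r A ≤ r B)
    (h_sub : ∀ A B, r (A ∪ B) + r (A ∩ B) ≤ r A + r B) {τ : ℝ} (hτ : 0 ≤ τ) (S : Finset ι)
    (hS : ∀ A ⊆ S, r S ≤ r A + τ * (S.card - A.card)) :
    ∃ w : ι → ℝ, (∀ i, 0 ≤ w i) ∧ (∀ i ∈ S, w i ≤ τ) ∧ (∀ A ⊆ S, ∑ i ∈ A, w i ≤ r A) ∧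
      ∑ i ∈ S, w i = r S := by
  let g : Finset ι → Finset ι → ℝ := fun T A => r A + τ * (T.card - A.card)
  let f : Finset ι → ℝ := fun T => T.powerset.inf' (Finset.powerset_nonempty T) (g T)
  have h_le : ∀ T A, A ⊆ T → f T ≤ g T A := fun T A hA =>
    Finset.inf'_le _ (Finset.mem_powerset.2 hA)
  have h_att : ∀ T, ∃ A ⊆ T, f T = g T A := fun T => by
    obtain ⟨A, hA, h⟩ := Finset.exists_mem_eq_inf' (Finset.powerset_nonempty T) (g T)
    exact ⟨A, Finset.mem_powerset.1 hA, h⟩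
  have h_self : ∀ T, f T ≤ r T := fun T => by simpa [g] using h_le T T subset_rfl
  have hf_empty : f ∅ = 0 := by
    obtain ⟨A, hA, h⟩ := h_att ∅
    simp [h, g, Finset.subset_empty.1 hA, h_empty]
  have h_card : ∀ A B : Finset ι, ((A ∪ B).card : ℝ) + (A ∩ B).card = A.card + B.card :=
    fun A B => by exact_mod_cast Finset.card_union_add_card_inter A B
  have hf_mono : ∀ T U, T ⊆ U → f T ≤ f U := fun T U hTU => by
    obtain ⟨A, hA, h⟩ := h_att U
    have h1 := h_le T (A ∩ T) Finset.inter_subset_right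
    have h2 := h_mono (A ∩ T) A Finset.inter_subset_left
    have h3 : ((A ∪ T).card : ℝ) ≤ U.card := by
      exact_mod_cast Finset.card_le_card (Finset.union_subset hA hTU)
    have h4 := h_card A T
    have h5 : τ * ((T.card : ℝ) - (A ∩ T).card) ≤ τ * (U.card - A.card) :=
      mul_le_mul_of_nonneg_left (by linarith) hτ
    simp only [g] at h h1
    linarith
  have hf_sub : ∀ T U, f (T ∪ U) + f (T ∩ U) ≤ f T + f U := fun T U => by
    obtain ⟨A, hA, h⟩ := h_att T
    obtain ⟨B, hB, h'⟩ := h_att U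
    have h1 := h_le (T ∪ U) (A ∪ B) (Finset.union_subset_union hA hB)
    have h2 := h_le (T ∩ U) (A ∩ B) (Finset.inter_subset_inter hA hB)
    have h3 := h_sub A B
    simp only [g] at h h' h1 h2
    linear_combination h1 + h2 + h3 - h - h' + τ * h_card T U - τ * h_card A B
  obtain ⟨w, hw0, hwA, hwS⟩ := exists_nonneg_sum_le_of_submodular f hf_empty hf_mono hf_sub S
  refine ⟨w, hw0, fun i hi => ?_, fun A hA => (hwA A hA).trans (h_self A), ?_⟩
  · have h1 := hwA {i} (Finset.singleton_subset_iff.2 hi)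
    have h2 := h_le {i} ∅ (Finset.empty_subset _)
    simp only [Finset.sum_singleton] at h1
    simp only [g, h_empty, Finset.card_singleton, Finset.card_empty] at h2
    norm_num at h2
    linarith
  · rw [hwS]
    obtain ⟨A, hA, h⟩ := h_att S
    exact le_antisymm (h_self S) (h ▸ hS A hA)

/-- Nochka weights for a corank function `d`. A set `A` is non-spanning when `1 ≤ d A`. -/
theorem exists_nochka_weights_of_corank {ι : Type*} [Fintype ι] [DecidableEq ι] {k n : ℕ}
    (hk : 1 ≤ k) (hkn : k ≤ n) (d : Finset ι → ℕ) (h_empty : d ∅ = k + 1)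
    (h_anti : ∀ A B, A ⊆ B → d B ≤ d A)
    (h_super : ∀ A B, d A + d B ≤ d (A ∪ B) + d (A ∩ B))
    (h_rank_one : ∀ i, k ≤ d {i})
    (h_loopless : ∀ A : Finset ι, A.Nonempty → d A ≤ k)
    (h_card : ∀ A : Finset ι, 1 ≤ d A → A.card + d A ≤ n + 1) :
    ∃ (τ : ℝ) (w : ι → ℝ), τ ≤ k / n ∧ (∀ i, 0 ≤ w i) ∧ (∀ i, w i ≤ τ) ∧
      (∀ A, 1 ≤ d A → ∑ i ∈ A, w i ≤ k + 1 - d A) ∧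
      ∑ i, w i = k + 1 + τ * (Fintype.card ι - (2 * n - k + 1)) := by
  have hk' : (1 : ℝ) ≤ k := by exact_mod_cast hk
  have hkn' : (k : ℝ) ≤ n := by exact_mod_cast hkn
  have h_card' : ∀ A : Finset ι, 1 ≤ d A → (A.card : ℝ) + d A ≤ n + 1 := fun A hA => by
    exact_mod_cast h_card A hA
  have h_one : ∀ A : Finset ι, 1 ≤ d A → (1 : ℝ) ≤ d A := fun A hA => by exact_mod_cast hA
  have h_pos : ∀ A : Finset ι, 1 ≤ d A → 0 < (2 * n - k + 1 - A.card : ℝ) := fun A hA => by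
    linarith [h_card' A hA, h_one A hA]
  obtain ⟨S, hS, hmax⟩ := Finset.exists_max_image
    ((Finset.univ : Finset (Finset ι)).filter fun A => 1 ≤ d A)
    (fun A => (d A : ℝ) / (2 * n - k + 1 - A.card)) ⟨∅, by simp [h_empty]⟩
  simp only [Finset.mem_filter, Finset.mem_univ, true_and] at hS hmax
  set τ : ℝ := (d S : ℝ) / (2 * n - k + 1 - S.card) with hτ
  have hτ0 : 0 ≤ τ := div_nonneg (Nat.cast_nonneg _) (h_pos S hS).le
  have hτS : (d S : ℝ) = τ * (2 * n - k + 1 - S.card) := by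
    rw [hτ, div_mul_cancel₀ _ (h_pos S hS).ne']
  have hτA : ∀ A, 1 ≤ d A → (d A : ℝ) ≤ τ * (2 * n - k + 1 - A.card) := fun A hA =>
    (div_le_iff₀ (h_pos A hA)).1 (hmax A hA)
  have hτk : τ ≤ k / n := by
    rw [hτ, div_le_div_iff₀ (h_pos S hS) (by linarith)]
    rcases S.eq_empty_or_nonempty with rfl | hne
    · simp only [h_empty, Finset.card_empty]
      push_cast
      nlinarith [mul_nonneg (sub_nonneg.2 hkn') (sub_nonneg.2 hk')]
    · have h1 : (d S : ℝ) ≤ k := by exact_mod_cast h_loopless S hne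
      nlinarith [mul_nonneg (sub_nonneg.2 hkn') (sub_nonneg.2 h1),
        mul_le_mul_of_nonneg_left (h_card' S hS) (zero_le_one.trans hk')]
  have hτ1 : τ ≤ 1 := hτk.trans (div_le_one_of_le₀ hkn' (Nat.cast_nonneg _))
  have h_super' : ∀ A B, (d A : ℝ) + d B ≤ d (A ∪ B) + d (A ∩ B) := fun A B => by
    exact_mod_cast h_super A B
  have h_anti' : ∀ A B, A ⊆ B → (d B : ℝ) ≤ d A := fun A B h => by
    exact_mod_cast h_anti A B h
  have h_unit : ∀ A : Finset ι, k + 1 ≤ A.card + d A := fun A => by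
    induction A using Finset.induction_on with
    | empty => simp [h_empty]
    | insert a A ha ih =>
      have h1 := h_super {a} A
      have h2 := h_rank_one a
      rw [← Finset.insert_eq, Finset.singleton_inter_of_notMem ha, h_empty] at h1
      rw [Finset.card_insert_of_notMem ha]
      omega
  have h_empty' : (d ∅ : ℝ) = k + 1 := by exact_mod_cast h_empty
  obtain ⟨v, hv0, hvτ, hvA, hvS⟩ := exists_bounded_sum_le_of_submodular
    (fun A => (k + 1 - d A : ℝ)) (by simp [h_empty']) (fun A B h => by linarith [h_anti' A B h])
    (fun A B => by linarith [h_super' A B]) hτ0 S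
    (fun A hA => by linarith [hτA A (hS.trans (h_anti A S hA))])
  have h_sum : ∀ A : Finset ι, ∑ i ∈ A, (if i ∈ S then v i else τ) =
      ∑ i ∈ A ∩ S, v i + τ * (A.card - (A ∩ S).card) := fun A => by
    have h1 : ((A \ S).card : ℝ) = A.card - (A ∩ S).card := by
      rw [eq_sub_iff_add_eq]
      exact_mod_cast Finset.card_sdiff_add_card_inter A S
    rw [Finset.sum_ite, Finset.filter_mem_eq_inter, Finset.sum_const, nsmul_eq_mul,
      Finset.filter_notMem_eq_sdiff, h1, mul_comm τ]
  refine ⟨τ, fun i => if i ∈ S then v i else τ, hτk, fun i => ?_, fun i => ?_, fun A hA => ?_, ?_⟩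
  · dsimp only
    split_ifs
    exacts [hv0 i, hτ0]
  · dsimp only
    split_ifs with h
    exacts [hvτ i h, le_rfl]
  · rw [h_sum]
    have h1 := hvA (A ∩ S) Finset.inter_subset_right
    have h2 : ((A ∪ S).card : ℝ) + (A ∩ S).card = A.card + S.card := by
      exact_mod_cast Finset.card_union_add_card_inter A S
    have h3 := h_super' A S
    suffices h : τ * ((A.card : ℝ) - (A ∩ S).card) ≤ d (A ∩ S) - d A by
      linarith
    rcases Nat.eq_zero_or_pos (d (A ∪ S)) with h0 | h0
    · -- The union spans: the excess of ranks bounds the excess of cardinalities.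
      have h4 : (k + 1 : ℝ) ≤ (A ∩ S).card + d (A ∩ S) := by
        exact_mod_cast h_unit (A ∩ S)
      rw [h0, Nat.cast_zero] at h3
      nlinarith [h_card' A hA, h_card' S hS]
    · have h4 := hτA _ h0
      have h5 : τ * (2 * n - k + 1 - (A ∪ S).card : ℝ) =
          τ * (2 * n - k + 1 - S.card) - τ * (A.card - (A ∩ S).card) := by
        linear_combination (-τ) * h2
      linarith
  · have h1 := h_sum Finset.univ
    rw [Finset.univ_inter, hvS, Finset.card_univ] at h1
    rw [h1]
    linear_combination -hτS

/-- **Nochka's theorem on weights (Main Theorem).**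
Linear subspaces `L` of `ℙᵏ` are recorded as their affine cones, i.e. as linear subspaces of
`F^(k+1)`; thus the nonempty subspaces are those with `L ≠ ⊥`, and the projective codimension of
a nonempty `L` is `codim L = k - dim L = (k + 1) - finrank L`.
If `H 1, …, H q` are hyperplanes of `ℙᵏ` (not necessarily distinct) in `n`-subgeneral position,
where `n ≥ k ≥ 1`, and `q > 2n - k + 1`, then there are weights `ω 1, …, ω q ∈ ℝ` with
(i) `ω i ≥ 0` for all `i`;
(ii) `ω i ≤ τ` for all `i`, where `τ = (∑ ω i - k - 1)/(q - 2n + k - 1)`;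
(iii) `∑_{i : H i ⊇ L} ω i ≤ codim L` for every nonempty linear subspace `L ⊆ ℙᵏ`. -/
theorem nochka_weights_toda (F : Type*) [Field F] (k n q : ℕ) (hk : 1 ≤ k) (hkn : k ≤ n)
    (H : Fin q → Submodule F (Fin (k + 1) → F))
    (hHhyp : ∀ i, Module.finrank F (H i) = k)
    (hpos : InSubgeneralPosition F k n q H)
    (hq : 2 * n + 1 < q + k) :
    ∃ ω : Fin q → ℝ,
      (∀ i, 0 ≤ ω i) ∧
      (∀ i, ω i ≤ ((∑ j, ω j) - k - 1) / ((q : ℝ) - 2 * n + k - 1)) ∧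
      (∀ L : Submodule F (Fin (k + 1) → F), L ≠ ⊥ →
        ∑ i ∈ Finset.univ.filter (fun i => L ≤ H i), ω i
          ≤ (k : ℝ) + 1 - Module.finrank F L) ∧
      ((∑ j, ω j) - k - 1) / ((q : ℝ) - 2 * n + k - 1) ≤ (k : ℝ) / (n : ℝ) := by
  obtain ⟨φ, H', hφ, ⟨-, -, hgen⟩, hH⟩ := hpos
  let d : Finset (Fin q) → ℕ := fun A => Module.finrank F ↥(⨅ i ∈ A, H i)
  have h_anti : ∀ A B, A ⊆ B → d B ≤ d A := fun A B h =>
    Submodule.finrank_mono (biInf_mono h)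
  have h_small : ∀ A : Finset (Fin q), A.card ≤ n + 1 → d A ≤ n + 1 - A.card := fun A hA => by
    have h_comap : (⨅ i ∈ A, H i) = (⨅ i ∈ A, H' i).comap φ := by
      simp only [Submodule.comap_iInf, hH]
    rw [← hgen A hA]
    change Module.finrank F ↥(⨅ i ∈ A, H i) ≤ _
    rw [h_comap, (Submodule.equivMapOfInjective φ hφ _).finrank_eq]
    exact Submodule.finrank_mono (Submodule.map_comap_le _ _)
  have h_card : ∀ A : Finset (Fin q), 1 ≤ d A → A.card + d A ≤ n + 1 := fun A hA => by
    rcases le_total A.card (n + 1) with h | h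
    · have := h_small A h
      omega
    · obtain ⟨B, hBA, hB⟩ := Finset.exists_subset_card_eq h
      have h1 := h_small B hB.le
      have h2 := h_anti B A hBA
      omega
  have h_empty : d ∅ = k + 1 := by
    change Module.finrank F ↥(⨅ i ∈ (∅ : Finset (Fin q)), H i) = k + 1
    rw [show (⨅ i ∈ (∅ : Finset (Fin q)), H i) = ⊤ by simp, finrank_top, Module.finrank_fin_fun]
  have h_single : ∀ i, d {i} = k := fun i => by
    change Module.finrank F ↥(⨅ j ∈ ({i} : Finset (Fin q)), H j) = k
    rw [Finset.iInf_singleton, hHhyp]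
  obtain ⟨τ, w, hτ, hw0, hwτ, hwA, hsum⟩ := exists_nochka_weights_of_corank hk hkn d
    h_empty h_anti
    (fun A B => by
      have h1 := Submodule.finrank_sup_add_finrank_inf_eq (⨅ i ∈ A, H i) (⨅ i ∈ B, H i)
      have h2 : ((⨅ i ∈ A, H i) ⊔ ⨅ i ∈ B, H i) ≤ ⨅ i ∈ A ∩ B, H i :=
        sup_le (biInf_mono fun i hi => (Finset.mem_inter.1 hi).1)
          (biInf_mono fun i hi => (Finset.mem_inter.1 hi).2)
      have h3 := Submodule.finrank_mono h2
      rw [← Finset.iInf_union] at h1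
      change _ + d (A ∪ B) = d A + d B at h1
      change _ ≤ d (A ∩ B) at h3
      change _ ≤ d (A ∪ B) + _
      omega)
    (fun i => (h_single i).ge)
    (fun A ⟨i, hi⟩ => (h_anti _ _ (Finset.singleton_subset_iff.2 hi)).trans (h_single i).le) h_card
  have hq' : (2 * n + 1 : ℝ) < q + k := by exact_mod_cast hq
  have h_eq : ((∑ j, w j) - k - 1) / ((q : ℝ) - 2 * n + k - 1) = τ := by
    rw [div_eq_iff (by linarith), hsum, Fintype.card_fin]
    ring
  rw [← h_eq] at hτ hwτ
  refine ⟨w, hw0, hwτ, fun L hL => ?_, hτ⟩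
  have h1 : L ≤ ⨅ i ∈ Finset.univ.filter (fun i => L ≤ H i), H i :=
    le_iInf₂ fun i hi => (Finset.mem_filter.1 hi).2
  have h2 := Submodule.finrank_mono h1
  have h3 := hwA _ ((Submodule.one_le_finrank_iff.2 hL).trans h2)
  have h4 : (Module.finrank F L : ℝ) ≤ d (Finset.univ.filter fun i => L ≤ H i) := by
    exact_mod_cast h2
  linarith
end

section
/- Let k and n be integers with n ≥ k ≥ 1, and let a, c, a′, c′ be integers satisfying: c ≥ 1, 0 ≤ c′ ≤ k, a ≤ c + n − k, a′ ≤ c′ + n − k, and c + c′ ≥ k + 1. Then (k + 1 − c′) · a ≤ (2n − k + 1 − a′) · c. Equivalently, setting σ = (k + 1 − c′)/(2n − k + 1 − a′) (which is well defined and positive since a′ ≤ c′ + n − k ≤ n < 2n − k + 1), one has σ · a ≤ c. -/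
/-- The arithmetic inequality underlying Case I of the proof of the Main Theorem.  Let `k, n` be
integers with `n ≥ k ≥ 1` and let `a, c, a', c'` be integers with `c ≥ 1`, `0 ≤ c' ≤ k`,
`a ≤ c + n - k`, `a' ≤ c' + n - k`, and `c + c' ≥ k + 1`.  Then
`(k + 1 - c') * a ≤ (2n - k + 1 - a') * c`; equivalently, setting
`σ = (k + 1 - c')/(2n - k + 1 - a')` (well defined and positive since
`a' ≤ c' + n - k ≤ n < 2n - k + 1`), one has `σ * a ≤ c`. -/
theorem nochka_case_one_ineq (k n a c a' c' : ℤ) (hk : 1 ≤ k) (hkn : k ≤ n)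
    (hc : 1 ≤ c) (hc'0 : 0 ≤ c') (hc'k : c' ≤ k)
    (ha : a ≤ c + n - k) (ha' : a' ≤ c' + n - k)
    (hcc' : k + 1 ≤ c + c') :
    (k + 1 - c') * a ≤ (2 * n - k + 1 - a') * c ∧
    ((k : ℝ) + 1 - c') / (2 * (n : ℝ) - k + 1 - a') * a ≤ (c : ℝ) := by
  have hint : (k + 1 - c') * a ≤ (2 * n - k + 1 - a') * c := by
    calc (k + 1 - c') * a ≤ (k + 1 - c') * (c + n - k) :=
          mul_le_mul_of_nonneg_left ha (by linarith)
      _ ≤ (n + 1 - c') * c := by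
          nlinarith [mul_nonneg (sub_nonneg.2 hkn) (sub_nonneg.2 hcc')]
      _ ≤ (2 * n - k + 1 - a') * c :=
          mul_le_mul_of_nonneg_right (by linarith) (by linarith)
  refine ⟨hint, ?_⟩
  have hpos : (0 : ℝ) < 2 * (n : ℝ) - k + 1 - a' := by
    have : 0 < 2 * n - k + 1 - a' := by linarith
    exact_mod_cast this
  rw [div_mul_eq_mul_div, div_le_iff₀ hpos, mul_comm (c : ℝ)]
  exact_mod_cast hint
end
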